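/- arXiv:1005.1819 — 2 statements merged into one kernel-verified Lean document; each statement's English description precedes it below -/
import Mathlib

section
/- For any bounded subset A of a Banach space E, the Kuratowski measure of noncompactness of the star [0,1]·A = {λx : λ ∈ [0,1], x ∈ A} equals that of A. -/
/-- Kuratowski measure of noncompactness. -/
noncomputable def kur {E : Type*} [NormedAddCommGroup E] (A : Set E) : ℝ :=
  sInf {d : ℝ | 0 < d ∧ ∃ S : Finset (Set E),
    (A ⊆ ⋃ s ∈ S, s) ∧ ∀ s ∈ S, EMetric.diam s < ENNReal.ofReal d}

/-- Every `d` admissible for a bounded set `A` is, up to `ε`, admissible for its star. -/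
theorem star_cover {E : Type*} [NormedAddCommGroup E] [NormedSpace ℝ E]
    {A : Set E} (hA : Bornology.IsBounded A) {d ε : ℝ} (hd : 0 < d) (hε : 0 < ε)
    {S : Finset (Set E)} (hAS : A ⊆ ⋃ s ∈ S, s)
    (hS : ∀ s ∈ S, Metric.ediam s < ENNReal.ofReal d) :
    ∃ T : Finset (Set E),
      (Set.image2 (fun (t : ℝ) (x : E) => t • x) (Set.Icc (0 : ℝ) 1) A ⊆ ⋃ s ∈ T, s) ∧
        ∀ s ∈ T, Metric.ediam s < ENNReal.ofReal (d + ε) := by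
  classical
  obtain ⟨M, hM, hAM⟩ := hA.exists_pos_norm_le
  obtain ⟨N, hN⟩ := exists_nat_gt (2 * M / ε)
  have hNpos : (0 : ℝ) < N := lt_trans (by positivity) hN
  have hMN : 2 * M < N * ε := by rwa [div_lt_iff₀ hε] at hN
  let P : Set E × ℕ → Set E := fun p =>
    Set.image2 (fun (t : ℝ) (x : E) => t • x) {t | t ∈ Set.Icc (0 : ℝ) 1 ∧ ⌊t * N⌋₊ = p.2}
      (p.1 ∩ A)
  refine ⟨(S ×ˢ Finset.range (N + 1)).image P, ?_, ?_⟩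
  · rintro _ ⟨t, ht, x, hx, rfl⟩
    obtain ⟨s, hs, hxs⟩ := Set.mem_iUnion₂.1 (hAS hx)
    refine Set.mem_iUnion₂.2 ⟨P (s, ⌊t * N⌋₊), Finset.mem_image_of_mem _ ?_,
      t, ⟨ht, rfl⟩, x, ⟨hxs, hx⟩, rfl⟩
    refine Finset.mem_product.2 ⟨hs, Finset.mem_range.2 (Nat.lt_succ_of_le ?_)⟩
    exact Nat.floor_le_of_le (mul_le_of_le_one_left hNpos.le ht.2)
  · intro _ hs
    obtain ⟨⟨s, k⟩, hp, rfl⟩ := Finset.mem_image.1 hs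
    have hsd := hS s (Finset.mem_product.1 hp).1
    refine lt_of_le_of_lt (b := ENNReal.ofReal (d + ε / 2)) (Metric.ediam_le ?_)
      ((ENNReal.ofReal_lt_ofReal_iff (by positivity)).2 (by linarith))
    rintro _ ⟨t, ⟨ht, htk⟩, x, ⟨hxs, hxA⟩, rfl⟩ _ ⟨u, ⟨hu, huk⟩, y, ⟨hys, hyA⟩, rfl⟩
    have hxy : dist x y < d := by
      have h := (Metric.edist_le_ediam_of_mem hxs hys).trans_lt hsd
      rwa [edist_dist, ENNReal.ofReal_lt_ofReal_iff hd] at h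
    have htu : |t - u| * N ≤ 1 := by
      have h₁ := Nat.floor_le (mul_nonneg ht.1 hNpos.le)
      have h₂ := Nat.lt_floor_add_one (t * N)
      have h₃ := Nat.floor_le (mul_nonneg hu.1 hNpos.le)
      have h₄ := Nat.lt_floor_add_one (u * N)
      simp only at htk huk
      rw [htk] at h₁ h₂
      rw [huk] at h₃ h₄
      rw [← abs_of_pos hNpos, ← abs_mul, abs_le]
      constructor <;> linarith
    have hM' : |t - u| * M ≤ ε / 2 := by
      have h : |t - u| * (2 * M) ≤ |t - u| * (N * ε) := by gcongr
      have h' : |t - u| * N * ε ≤ 1 * ε := by gcongr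
      linarith
    rw [edist_dist]
    refine ENNReal.ofReal_le_ofReal ?_
    rw [dist_eq_norm] at hxy ⊢
    calc ‖t • x - u • y‖ = ‖t • (x - y) + (t - u) • y‖ := by
          congr 1; module
      _ ≤ ‖t • (x - y)‖ + ‖(t - u) • y‖ := norm_add_le _ _
      _ = t * ‖x - y‖ + |t - u| * ‖y‖ := by
          rw [norm_smul, norm_smul, Real.norm_eq_abs, Real.norm_eq_abs, abs_of_nonneg ht.1]
      _ ≤ 1 * ‖x - y‖ + |t - u| * M := by
          gcongr
          · exact ht.2
          · exact hAM y hyA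
      _ ≤ d + ε / 2 := by linarith

/-- A bounded set has a finite covering by sets of small enough diameter for some bound. -/
theorem exists_kur_cover {E : Type*} [NormedAddCommGroup E] {A : Set E}
    (hA : Bornology.IsBounded A) :
    {d : ℝ | 0 < d ∧ ∃ S : Finset (Set E),
      (A ⊆ ⋃ s ∈ S, s) ∧ ∀ s ∈ S, Metric.ediam s < ENNReal.ofReal d}.Nonempty := by
  refine ⟨Metric.diam A + 1, by positivity, {A}, by simp, ?_⟩
  intro s hs
  rw [Finset.mem_singleton.1 hs, ← ENNReal.ofReal_toReal hA.ediam_ne_top]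
  exact (ENNReal.ofReal_lt_ofReal_iff (by positivity)).2 (lt_add_one (Metric.diam A))

theorem kur_star {E : Type*} [NormedAddCommGroup E] [NormedSpace ℝ E] [CompleteSpace E]
    (A : Set E) (hA : Bornology.IsBounded A) :
    kur (Set.image2 (fun (t : ℝ) (x : E) => t • x) (Set.Icc (0 : ℝ) 1) A) = kur A := by
  have hbdd : ∀ B : Set E, BddBelow {d : ℝ | 0 < d ∧ ∃ S : Finset (Set E),
      (B ⊆ ⋃ s ∈ S, s) ∧ ∀ s ∈ S, Metric.ediam s < ENNReal.ofReal d} :=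
    fun B => ⟨0, fun d hd => hd.1.le⟩
  apply le_antisymm
  · refine le_csInf (exists_kur_cover hA) ?_
    rintro d ⟨hd, S, hAS, hS⟩
    refine le_of_forall_pos_le_add fun ε hε => csInf_le (hbdd _) ?_
    exact ⟨by positivity, star_cover hA hd hε hAS hS⟩
  · refine csInf_le_csInf (hbdd A) ?_ ?_
    · obtain ⟨d, hd, S, hAS, hS⟩ := exists_kur_cover hA
      exact ⟨d + 1, by positivity, star_cover hA hd one_pos hAS hS⟩
    · rintro d ⟨hd, S, hAS, hS⟩
      refine ⟨hd, S, fun x hx => hAS ⟨1, by simp, x, hx, one_smul ℝ x⟩, hS⟩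
end

section
/- Let f : E → F be a positively homogeneous continuous map between real Banach spaces such that ω(f) > 0. Then the equation f(x) = 0 has only the trivial solution x = 0 if and only if d(f) := inf_{‖x‖=1} ‖f(x)‖ > 0. -/
/-- The lower measure of noncompactness `ω(f)` of a map. -/
noncomputable def omegaNum {E F : Type*} [NormedAddCommGroup E] [NormedAddCommGroup F]
    (f : E → F) : ℝ :=
  sInf {r : ℝ | ∃ A : Set E, Bornology.IsBounded A ∧ 0 < kur A ∧ r = kur (f '' A) / kur A}

/-- The radii occurring in the definition of `kur A` are bounded below by zero. -/
theorem kur_set_bddBelow {E : Type*} [NormedAddCommGroup E] (A : Set E) :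
    BddBelow {d : ℝ | 0 < d ∧ ∃ S : Finset (Set E),
      (A ⊆ ⋃ s ∈ S, s) ∧ ∀ s ∈ S, Metric.ediam s < ENNReal.ofReal d} :=
  ⟨0, fun _ hd => hd.1.le⟩

theorem kur_nonneg {E : Type*} [NormedAddCommGroup E] (A : Set E) : 0 ≤ kur A :=
  Real.sInf_nonneg fun _ hd => hd.1.le

theorem kur_eq_zero_of_totallyBounded {E : Type*} [NormedAddCommGroup E] {A : Set E}
    (hA : TotallyBounded A) : kur A = 0 := by
  refine le_antisymm (le_of_forall_pos_le_add fun ε hε => ?_) (kur_nonneg A)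
  rw [zero_add]
  refine csInf_le (kur_set_bddBelow A) ⟨hε, ?_⟩
  obtain ⟨t, ht, hAt⟩ := Metric.totallyBounded_iff.1 hA (ε / 3) (by positivity)
  classical
  refine ⟨ht.toFinset.image fun y => Metric.ball y (ε / 3), by simpa using hAt, fun s hs => ?_⟩
  obtain ⟨y, -, rfl⟩ := Finset.mem_image.1 hs
  have hdiam : Metric.ediam (Metric.ball y (ε / 3)) ≤ ENNReal.ofReal (2 * (ε / 3)) := by
    refine Metric.ediam_le fun a ha b hb => ?_
    rw [edist_dist]
    refine ENNReal.ofReal_le_ofReal ?_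
    have := dist_triangle_right a b y
    rw [Metric.mem_ball] at ha hb
    linarith
  exact hdiam.trans_lt ((ENNReal.ofReal_lt_ofReal_iff hε).2 (by linarith))

theorem totallyBounded_of_kur_eq_zero {E : Type*} [NormedAddCommGroup E] {A : Set E}
    (hA : Bornology.IsBounded A) (h : kur A = 0) : TotallyBounded A := by
  refine Metric.totallyBounded_iff.2 fun ε hε => ?_
  have hne : {d : ℝ | 0 < d ∧ ∃ S : Finset (Set E),
      (A ⊆ ⋃ s ∈ S, s) ∧ ∀ s ∈ S, Metric.ediam s < ENNReal.ofReal d}.Nonempty := by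
    have hd : 0 < Metric.diam A + 1 := by linarith [Metric.diam_nonneg (s := A)]
    refine ⟨Metric.diam A + 1, hd, {A}, by simp, fun s hs => ?_⟩
    rw [Finset.mem_singleton.1 hs]
    exact (ENNReal.lt_ofReal_iff_toReal_lt hA.ediam_ne_top).2 (lt_add_one (Metric.diam A))
  obtain ⟨d, ⟨hd, S, hAS, hS⟩, hdε⟩ := exists_lt_of_csInf_lt hne (h.trans_lt hε)
  classical
  refine ⟨(fun s : Set E => if hs : s.Nonempty then hs.some else 0) '' S,
    S.finite_toSet.image _, fun a ha => ?_⟩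
  obtain ⟨s, hs, has⟩ := Set.mem_iUnion₂.1 (hAS ha)
  have hsne : s.Nonempty := ⟨a, has⟩
  refine Set.mem_iUnion₂.2 ⟨hsne.some, ⟨s, hs, dif_pos hsne⟩, ?_⟩
  have hlt := (Metric.edist_le_ediam_of_mem has hsne.some_mem).trans_lt (hS s hs)
  rw [edist_dist, ENNReal.ofReal_lt_ofReal_iff hd] at hlt
  exact Metric.mem_ball.2 (hlt.trans hdε)

/-- If `ω(f) > 0`, then bounded sets with totally bounded image are totally bounded. -/
theorem totallyBounded_of_image_of_omegaNum_pos {E F : Type*} [NormedAddCommGroup E]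
    [NormedAddCommGroup F] {f : E → F} (hω : 0 < omegaNum f) {A : Set E}
    (hA : Bornology.IsBounded A) (hfA : TotallyBounded (f '' A)) : TotallyBounded A := by
  refine totallyBounded_of_kur_eq_zero hA ?_
  by_contra hne
  refine hω.not_ge (csInf_le ⟨0, ?_⟩
    ⟨A, hA, (kur_nonneg A).lt_of_ne' hne, by simp [kur_eq_zero_of_totallyBounded hfA]⟩)
  rintro r ⟨B, -, -, rfl⟩
  exact div_nonneg (kur_nonneg _) (kur_nonneg _)

theorem nontrivial_of_omegaNum_pos {E F : Type*} [NormedAddCommGroup E]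
    [NormedAddCommGroup F] {f : E → F} (hω : 0 < omegaNum f) : Nontrivial E := by
  by_contra hE
  rw [not_nontrivial_iff_subsingleton] at hE
  refine hω.ne' ((congrArg sInf (Set.eq_empty_of_forall_notMem ?_)).trans Real.sInf_empty)
  rintro r ⟨A, -, hA, -⟩
  exact hA.ne' (kur_eq_zero_of_totallyBounded A.toFinite.totallyBounded)

theorem posHom_trivial_kernel_iff {E F : Type*}
    [NormedAddCommGroup E] [NormedSpace ℝ E] [CompleteSpace E]
    [NormedAddCommGroup F] [NormedSpace ℝ F] [CompleteSpace F]
    (f : E → F) (hf : Continuous f)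
    (hpos : ∀ t : ℝ, 0 ≤ t → ∀ x : E, f (t • x) = t • f x)
    (hω : 0 < omegaNum f) :
    (∀ x : E, f x = 0 → x = 0) ↔
      0 < sInf {r : ℝ | ∃ x : E, ‖x‖ = 1 ∧ r = ‖f x‖} := by
  have hbdd : BddBelow {r : ℝ | ∃ x : E, ‖x‖ = 1 ∧ r = ‖f x‖} := by
    refine ⟨0, ?_⟩
    rintro r ⟨x, -, rfl⟩
    exact norm_nonneg _
  constructor
  · intro hker
    by_contra hnot
    have := nontrivial_of_omegaNum_pos hω
    obtain ⟨e, he⟩ := exists_norm_eq E zero_le_one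
    have hne : {r : ℝ | ∃ x : E, ‖x‖ = 1 ∧ r = ‖f x‖}.Nonempty := ⟨‖f e‖, e, he, rfl⟩
    have hsmall (n : ℕ) : ∃ x : E, ‖x‖ = 1 ∧ ‖f x‖ < 1 / ((n : ℝ) + 1) := by
      obtain ⟨r, ⟨x, hx, rfl⟩, hr⟩ := exists_lt_of_csInf_lt hne
        ((not_lt.1 hnot).trans_lt (Nat.one_div_pos_of_nat (n := n)))
      exact ⟨x, hx, hr⟩
    choose x hx hfx using hsmall
    have hlim : Filter.Tendsto (f ∘ x) Filter.atTop (nhds 0) :=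
      squeeze_zero_norm (fun n => (hfx n).le) tendsto_one_div_add_atTop_nhds_zero_nat
    have hA : Bornology.IsBounded (Set.range x) :=
      isBounded_iff_forall_norm_le.2 ⟨1, by rintro _ ⟨n, rfl⟩; exact (hx n).le⟩
    have htb : TotallyBounded (Set.range x) := by
      refine totallyBounded_of_image_of_omegaNum_pos hω hA ?_
      rw [← Set.range_comp]
      exact hlim.cauchySeq.totallyBounded_range
    obtain ⟨a, -, φ, hφ, ha⟩ := htb.closure.isCompact_of_isClosed isClosed_closure
      |>.tendsto_subseq fun n => subset_closure (Set.mem_range_self n)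
    have hfa : f a = 0 := tendsto_nhds_unique ((hf.tendsto a).comp ha)
      (hlim.comp hφ.tendsto_atTop)
    have hna : ‖a‖ = 1 := tendsto_nhds_unique ha.norm (by simp [hx])
    simp [hker a hfa] at hna
  · intro hd x hfx
    by_contra hx
    refine hd.not_ge (csInf_le hbdd ⟨‖x‖⁻¹ • x, norm_smul_inv_norm (𝕜 := ℝ) hx, ?_⟩)
    rw [hpos _ (by positivity), hfx, smul_zero, norm_zero]
end
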